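/- arXiv:2505.07568 — 5 statements merged into one kernel-verified Lean document; each statement's English description precedes it below -/
import Mathlib

section
/- Let H be a complex Hilbert space and let s and t be densely defined self-adjoint unbounded operators on H such that: for every x in the domain of t, t x lies in the domain of s and s (t x) = 0; and for every x in the domain of s, s x lies in the domain of t and t (s x) = 0. Then the domain dom s ∩ dom t is dense in H and the unbounded operator with domain dom s ∩ dom t sending x to s x + t x is self-adjoint. -/
open scoped InnerProductSpace

namespace LinearPMap

variable {𝕜 E : Type*} [RCLike 𝕜] [NormedAddCommGroup E] [InnerProductSpace 𝕜 E] [CompleteSpace E]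
  {T : E →ₗ.[𝕜] E}

/-- A self-adjoint operator with dense domain is symmetric. -/
theorem inner_apply_left_of_adjoint_eq (hT : Dense (T.domain : Set E)) (hadj : T.adjoint = T)
    (x y : T.domain) : ⟪T x, (y : E)⟫_𝕜 = ⟪(x : E), T y⟫_𝕜 := by
  have h := adjoint_isFormalAdjoint hT
  rw [hadj] at h
  exact h x y

/-- If `w` represents the functional `x ↦ ⟪y, T x⟫` for a self-adjoint operator `T`, then `y`
belongs to the domain of `T` and `T y = w`. -/
theorem exists_mem_domain_apply_eq_of_adjoint_eq (hT : Dense (T.domain : Set E))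
    (hadj : T.adjoint = T) {y w : E} (h : ∀ x : T.domain, ⟪w, (x : E)⟫_𝕜 = ⟪y, T x⟫_𝕜) :
    ∃ hy : y ∈ T.domain, T ⟨y, hy⟩ = w := by
  have hy : y ∈ T.domain := hadj ▸ mem_adjoint_domain_of_exists y ⟨w, h⟩
  refine ⟨hy, hT.eq_of_inner_left 𝕜 fun v hv => ?_⟩
  rw [inner_apply_left_of_adjoint_eq hT hadj ⟨y, hy⟩ ⟨v, hv⟩, h ⟨v, hv⟩]

/-- The orthogonal complement of the range of a self-adjoint operator is contained in its
kernel. -/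
theorem exists_apply_eq_zero_of_mem_orthogonal_range (hT : Dense (T.domain : Set E))
    (hadj : T.adjoint = T) {y : E} (hy : y ∈ (LinearMap.range T.toFun)ᗮ) :
    ∃ h : y ∈ T.domain, T ⟨y, h⟩ = 0 :=
  exists_mem_domain_apply_eq_of_adjoint_eq hT hadj fun x => by
    rw [inner_zero_left]
    exact ((Submodule.mem_orthogonal' _ _).1 hy _ ⟨x, rfl⟩).symm

/-- If `z` is in the kernel of `T`, then `x - z` has the same image as `x`. -/
theorem exists_apply_sub_eq_of_apply_eq_zero {R M N : Type*} [Ring R] [AddCommGroup M] [Module R M]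
    [AddCommGroup N] [Module R N] {T : M →ₗ.[R] N} (x : T.domain) {z : M}
    (hz : ∃ h : z ∈ T.domain, T ⟨z, h⟩ = 0) :
    ∃ h : (x : M) - z ∈ T.domain, T ⟨x - z, h⟩ = T x := by
  obtain ⟨h, h0⟩ := hz
  refine ⟨T.domain.sub_mem x.2 h, ?_⟩
  have := T.map_sub x ⟨z, h⟩
  rw [h0, sub_zero] at this
  exact this

end LinearPMap


/-- Let `s` and `t` be densely defined self-adjoint unbounded operators on a
complex Hilbert space `H` such that `s ∘ t = 0` and `t ∘ s = 0` (in the sense that `t` maps its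
domain into the domain of `s` with `s (t x) = 0`, and vice versa). Then `s + t` (the unbounded
operator with domain `dom s ⊓ dom t`, sending `x` to `s x + t x`) is densely defined and
self-adjoint. -/
theorem selfAdjoint_add_of_orthogonal_squares
    {H : Type*} [NormedAddCommGroup H] [InnerProductSpace ℂ H] [CompleteSpace H]
    (s t : H →ₗ.[ℂ] H)
    (hs_dense : Dense (s.domain : Set H)) (ht_dense : Dense (t.domain : Set H))
    (hs_sa : s.adjoint = s) (ht_sa : t.adjoint = t)
    (hst : ∀ x : t.domain, ∃ h : t x ∈ s.domain, s ⟨t x, h⟩ = 0)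
    (hts : ∀ x : s.domain, ∃ h : s x ∈ t.domain, t ⟨s x, h⟩ = 0) :
    Dense ((s + t).domain : Set H) ∧ (s + t).adjoint = s + t := by
  set N : Submodule ℂ H := (LinearMap.range s.toFun)ᗮ with hN
  have ker_s : ∀ x : H, ∃ h : N.starProjection x ∈ s.domain, s ⟨_, h⟩ = 0 := fun x =>
    LinearPMap.exists_apply_eq_zero_of_mem_orthogonal_range hs_dense hs_sa
      (N.starProjection_apply_mem x)
  have range_t_le : LinearMap.range t.toFun ≤ N := by
    rintro _ ⟨x, rfl⟩
    rw [hN, Submodule.mem_orthogonal']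
    rintro _ ⟨z, rfl⟩
    obtain ⟨h, h0⟩ := hst x
    have key := LinearPMap.inner_apply_left_of_adjoint_eq hs_dense hs_sa ⟨t x, h⟩ z
    rw [h0, inner_zero_left] at key
    exact key.symm
  have ker_t : ∀ x : H, ∃ h : x - N.starProjection x ∈ t.domain, t ⟨_, h⟩ = 0 := fun x =>
    LinearPMap.exists_apply_eq_zero_of_mem_orthogonal_range ht_dense ht_sa
      (Submodule.orthogonal_le range_t_le (N.sub_starProjection_mem_orthogonal x))
  have apply_s : ∀ x : s.domain, ∃ h : (x : H) - N.starProjection x ∈ s.domain,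
      s ⟨_, h⟩ = s x := fun x =>
    LinearPMap.exists_apply_sub_eq_of_apply_eq_zero x (ker_s x)
  have apply_t : ∀ x : t.domain, ∃ h : N.starProjection (x : H) ∈ t.domain,
      t ⟨_, h⟩ = t x := fun x => by
    simpa using LinearPMap.exists_apply_sub_eq_of_apply_eq_zero x (ker_t x)
  have dense_add : Dense ((s + t).domain : Set H) := by
    have hcont : Continuous fun p : H × H => p.1 - N.starProjection p.1 + N.starProjection p.2 := by
      fun_prop
    have hsurj : Function.Surjective
        fun p : H × H => p.1 - N.starProjection p.1 + N.starProjection p.2 :=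
      fun x => ⟨(x, x), by simp⟩
    refine (hsurj.denseRange.dense_image hcont (hs_dense.prod ht_dense)).mono ?_
    rintro _ ⟨⟨a, b⟩, ⟨ha, hb⟩, rfl⟩
    exact ⟨s.domain.add_mem (apply_s ⟨a, ha⟩).1 (ker_s b).1,
      t.domain.add_mem (ker_t a).1 (apply_t ⟨b, hb⟩).1⟩
  have formal : (s + t).IsFormalAdjoint (s + t) := fun x y => by
    rw [LinearPMap.add_apply, LinearPMap.add_apply, inner_add_left, inner_add_right]
    exact congrArg₂ (· + ·)
      (LinearPMap.inner_apply_left_of_adjoint_eq hs_dense hs_sa ⟨x, x.2.1⟩ ⟨y, y.2.1⟩)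
      (LinearPMap.inner_apply_left_of_adjoint_eq ht_dense ht_sa ⟨x, x.2.2⟩ ⟨y, y.2.2⟩)
  refine ⟨dense_add, (LinearPMap.eq_of_le_of_domain_eq (formal.le_adjoint dense_add)
    (le_antisymm (formal.le_adjoint dense_add).1 fun y hy => ?_)).symm⟩
  have adj := LinearPMap.adjoint_isFormalAdjoint dense_add ⟨y, hy⟩
  set w : H := (s + t).adjoint ⟨y, hy⟩
  refine ⟨(LinearPMap.exists_mem_domain_apply_eq_of_adjoint_eq hs_dense hs_sa
      (w := w - N.starProjection w) fun x => ?_).1,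
    (LinearPMap.exists_mem_domain_apply_eq_of_adjoint_eq ht_dense ht_sa
      (w := N.starProjection w) fun x => ?_).1⟩
  · obtain ⟨h₁, h₁'⟩ := apply_s x
    obtain ⟨h₂, h₂'⟩ := ker_t x
    have key := adj ⟨_, h₁, h₂⟩
    rw [LinearPMap.add_apply, h₁', h₂', add_zero] at key
    rw [inner_sub_left, Submodule.inner_starProjection_left_eq_right, ← inner_sub_right]
    exact key
  · obtain ⟨h₁, h₁'⟩ := ker_s x
    obtain ⟨h₂, h₂'⟩ := apply_t x
    have key := adj ⟨_, h₁, h₂⟩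
    rw [LinearPMap.add_apply, h₁', h₂', zero_add] at key
    rw [Submodule.inner_starProjection_left_eq_right]
    exact key
end

section
/- Let (H_k, S_k)_{k=0}^{N} be a finite-length quasicomplex of Hilbert spaces of length N. Suppose there exist bounded operators P_k : H_{k+1} → H_k (0 ≤ k ≤ N, and P_k = 0 otherwise) such that for every 0 ≤ k ≤ N+1 the operator D_k := P_k ∘ S_k + S_{k-1} ∘ P_{k-1} : H_k → H_k is Fredholm in the sense that there is a bounded R_k : H_k → H_k with id − R_k ∘ D_k and id − D_k ∘ R_k compact. Then the quasicomplex admits a parametrix. -/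
/-- An operator that intertwines `D₁` and `D₂` modulo compact operators also intertwines a right
inverse of `D₁` and a left inverse of `D₂` modulo compact operators. -/
theorem IsCompactOperator.intertwine_inverses {𝕜 E F : Type*} [NontriviallyNormedField 𝕜]
    [NormedAddCommGroup E] [NormedSpace 𝕜 E] [NormedAddCommGroup F] [NormedSpace 𝕜 F]
    {D₁ R₁ : E →L[𝕜] E} {D₂ R₂ : F →L[𝕜] F} {T : E →L[𝕜] F}
    (hT : IsCompactOperator (fun x : E => T (D₁ x) - D₂ (T x)))
    (h₁ : IsCompactOperator (fun x : E => x - D₁ (R₁ x)))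
    (h₂ : IsCompactOperator (fun x : F => x - R₂ (D₂ x))) :
    IsCompactOperator (fun x : E => R₂ (T x) - T (R₁ x)) := by
  refine Eq.mp (congrArg IsCompactOperator (funext fun x => ?_))
    (((h₁.clm_comp (R₂ ∘L T)).add ((hT.comp_clm R₁).clm_comp R₂)).sub (h₂.comp_clm (T ∘L R₁)))
  simp

/-- The Laplacians `P k ∘ S k + S (k-1) ∘ P (k-1)` associated with two families of maps in
opposite directions, where the second summand is absent for `k = 0`. -/
noncomputable def associatedLaplacian {𝕜 : Type*} [NontriviallyNormedField 𝕜] {H : ℕ → Type*}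
    [∀ k, NormedAddCommGroup (H k)] [∀ k, NormedSpace 𝕜 (H k)]
    (S : ∀ k, H k →L[𝕜] H (k + 1)) (P : ∀ k, H (k + 1) →L[𝕜] H k) : ∀ k, H k →L[𝕜] H k
  | 0 => P 0 ∘L S 0
  | k + 1 => P (k + 1) ∘L S (k + 1) + S k ∘L P k

/-- If `S (k+1) ∘ S k` is compact for all `k`, then `S` intertwines the associated Laplacians
modulo compact operators. -/
theorem isCompactOperator_associatedLaplacian_commutator {𝕜 : Type*} [NontriviallyNormedField 𝕜]
    {H : ℕ → Type*} [∀ k, NormedAddCommGroup (H k)] [∀ k, NormedSpace 𝕜 (H k)]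
    {S : ∀ k, H k →L[𝕜] H (k + 1)}
    (hS : ∀ k, IsCompactOperator (fun x : H k => S (k + 1) (S k x)))
    (P : ∀ k, H (k + 1) →L[𝕜] H k) (k : ℕ) :
    IsCompactOperator (fun x : H k =>
      S k (associatedLaplacian S P k x) - associatedLaplacian S P (k + 1) (S k x)) := by
  cases k with
  | zero =>
    refine Eq.mp (congrArg IsCompactOperator (funext fun x => ?_)) ((hS 0).clm_comp (P 1)).neg
    simp [associatedLaplacian]
  | succ j =>
    refine Eq.mp (congrArg IsCompactOperator (funext fun x => ?_))
      (((hS j).comp_clm (P j)).sub ((hS (j + 1)).clm_comp (P (j + 2))))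
    simp only [associatedLaplacian, add_apply, ContinuousLinearMap.comp_apply, Pi.sub_apply,
      Function.comp_apply, map_add]
    abel

/-- Let `(H k, S k)_{k=0}^N` be a finite-length quasicomplex of Hilbert spaces
(with the convention `S k = 0` for `k > N`).  If there are bounded operators
`P k : H (k+1) → H k` (zero for `k > N`) such that every operator
`D k = P k ∘ S k + S (k-1) ∘ P (k-1)` (for `0 ≤ k ≤ N+1`) is Fredholm, then the quasicomplex
admits a parametrix.  (The conditions at index `k = 0` are stated separately; for `k = j+1` with
`0 ≤ j ≤ N` they are stated at index `j+1`.) -/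
theorem quasicomplex_parametrix_of_associated_maps
    (N : ℕ) (H : ℕ → Type*)
    [∀ k, NormedAddCommGroup (H k)] [∀ k, InnerProductSpace ℂ (H k)] [∀ k, CompleteSpace (H k)]
    (S : ∀ k, H k →L[ℂ] H (k+1))
    (hS0 : ∀ k, N < k → S k = 0)
    (hquasi : ∀ k, k + 1 ≤ N → IsCompactOperator (fun x : H k => S (k+1) (S k x)))
    (P : ∀ k, H (k+1) →L[ℂ] H k)
    (hP0 : ∀ k, N < k → P k = 0)
    (hD0 : ∃ R : H 0 →L[ℂ] H 0,
      IsCompactOperator (fun x : H 0 => x - R (P 0 (S 0 x))) ∧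
      IsCompactOperator (fun x : H 0 => x - P 0 (S 0 (R x))))
    (hD : ∀ j : ℕ, j ≤ N → ∃ R : H (j+1) →L[ℂ] H (j+1),
      IsCompactOperator (fun x : H (j+1) => x - R (P (j+1) (S (j+1) x) + S j (P j x))) ∧
      IsCompactOperator (fun x : H (j+1) => x - (P (j+1) (S (j+1) (R x)) + S j (P j (R x))))) :
    ∃ Q : ∀ k, H (k+1) →L[ℂ] H k,
      (∀ k, N < k → Q k = 0) ∧
      IsCompactOperator (fun x : H 0 => x - Q 0 (S 0 x)) ∧
      ∀ j : ℕ, j ≤ N →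
        IsCompactOperator (fun x : H (j+1) => x - (Q (j+1) (S (j+1) x) + S j (Q j x))) := by
  have hSS (k : ℕ) : IsCompactOperator (fun x : H k => S (k + 1) (S k x)) := by
    by_cases hk : k + 1 ≤ N
    · exact hquasi k hk
    · simpa [hS0 (k + 1) (by omega)] using! isCompactOperator_zero
  have hR (k : ℕ) : ∃ R : H k →L[ℂ] H k, k ≤ N + 1 →
      IsCompactOperator (fun x : H k => x - R (associatedLaplacian S P k x)) ∧
      IsCompactOperator (fun x : H k => x - associatedLaplacian S P k (R x)) := by
    by_cases hk : k ≤ N + 1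
    · cases k with
      | zero =>
        obtain ⟨R, h⟩ := hD0
        exact ⟨R, fun _ => h⟩
      | succ j =>
        obtain ⟨R, h⟩ := hD j (by omega)
        exact ⟨R, fun _ => h⟩
    · exact ⟨0, fun h => absurd h hk⟩
  choose R hR using hR
  refine ⟨fun k => R k ∘L P k, fun k hk => by simp [hP0 k hk], (hR 0 (by omega)).1, ?_⟩
  intro j hj
  have hRS := IsCompactOperator.intertwine_inverses
    (isCompactOperator_associatedLaplacian_commutator hSS P j)
    (hR j (by omega)).2 (hR (j + 1) (by omega)).1
  refine Eq.mp (congrArg IsCompactOperator (funext fun x => ?_))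
    ((hR (j + 1) (by omega)).1.add (hRS.comp_clm (P j)))
  simp only [associatedLaplacian, add_apply, ContinuousLinearMap.comp_apply,
    Pi.add_apply, Function.comp_apply, map_add]
  abel
end

section
/- Let (H_k, S_k)_{k=0}^{N} be a finite-length quasicomplex of Hilbert spaces of length N that admits a parametrix. Then it admits a parametrix (P_k)_{k=0}^{N} that is itself a quasicomplex, i.e. in addition P_k ∘ P_{k+1} : H_{k+2} → H_k is compact for every 0 ≤ k ≤ N−1. -/
theorem IsCompactOperator.of_forall_eq {M₁ M₂ : Type*} [Zero M₁] [TopologicalSpace M₁]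
    [TopologicalSpace M₂] {f g : M₁ → M₂} (hf : IsCompactOperator f) (h : ∀ x, f x = g x) :
    IsCompactOperator g :=
  funext h ▸ hf

/-- A finite-length quasicomplex of Hilbert spaces `(H k, S k)_{k=0}^N`
(convention: `S k = 0` for `k > N`) that admits a parametrix admits a parametrix `(P k)` that is
itself a quasicomplex, i.e. additionally `P k ∘ P (k+1)` is compact for `0 ≤ k ≤ N-1`. -/
theorem quasicomplex_parametrix_of_parametrix
    (N : ℕ) (H : ℕ → Type*)
    [∀ k, NormedAddCommGroup (H k)] [∀ k, InnerProductSpace ℂ (H k)] [∀ k, CompleteSpace (H k)]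
    (S : ∀ k, H k →L[ℂ] H (k+1))
    (hS0 : ∀ k, N < k → S k = 0)
    (hquasi : ∀ k, k + 1 ≤ N → IsCompactOperator (fun x : H k => S (k+1) (S k x)))
    (P : ∀ k, H (k+1) →L[ℂ] H k)
    (hP0 : ∀ k, N < k → P k = 0)
    (hpar0 : IsCompactOperator (fun x : H 0 => x - P 0 (S 0 x)))
    (hpar : ∀ j : ℕ, j ≤ N →
      IsCompactOperator (fun x : H (j+1) => x - (P (j+1) (S (j+1) x) + S j (P j x)))) :
    ∃ Q : ∀ k, H (k+1) →L[ℂ] H k,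
      (∀ k, N < k → Q k = 0) ∧
      IsCompactOperator (fun x : H 0 => x - Q 0 (S 0 x)) ∧
      (∀ j : ℕ, j ≤ N →
        IsCompactOperator (fun x : H (j+1) => x - (Q (j+1) (S (j+1) x) + S j (Q j x)))) ∧
      (∀ k, k + 1 ≤ N → IsCompactOperator (fun x : H (k+2) => Q k (Q (k+1) x))) := by
  -- modulo compact operators, `S k ∘ P k ∘ S k = S k`
  have hSPS : ∀ k, IsCompactOperator (fun x : H k => S k x - S k (P k (S k x))) := by
    rintro (_ | k)
    · simpa [Function.comp_def] using hpar0.clm_comp (S 0)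
    · by_cases hk : k + 1 ≤ N
      · refine (((hpar k (by omega)).clm_comp (S (k + 1))).add
          ((hquasi k hk).comp_clm (P k))).of_forall_eq fun x => ?_
        simp only [Pi.add_apply, Function.comp_apply, map_sub, map_add]
        abel
      · exact isCompactOperator_zero.of_forall_eq fun x => by simp [hS0 (k + 1) (by omega)]
  refine ⟨fun k => P k ∘L S k ∘L P k, fun k hk => ?_, ?_, fun j hj => ?_, fun k hk => ?_⟩
  · simp [hP0 k hk]
  · refine (hpar0.add ((hSPS 0).clm_comp (P 0))).of_forall_eq fun x => ?_
    simp only [Pi.add_apply, Function.comp_apply, ContinuousLinearMap.comp_apply, map_sub]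
    abel
  · refine (((hpar j hj).add ((hSPS (j + 1)).clm_comp (P (j + 1)))).add
      ((hSPS j).comp_clm (P j))).of_forall_eq fun x => ?_
    simp only [Pi.add_apply, Function.comp_apply, ContinuousLinearMap.comp_apply, map_sub]
    abel
  · refine ((((hSPS k).clm_comp (P k)).comp_clm (P k ∘L P (k + 1))).sub
      (((hpar k (by omega)).clm_comp (P k ∘L S k ∘L P k)).comp_clm (P (k + 1)))).of_forall_eq
        fun x => ?_
    simp only [Pi.sub_apply, Function.comp_apply, ContinuousLinearMap.comp_apply, map_sub,
      map_add]
    abel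
end

section
/- Let (H_k, d_k)_{k=0}^{N} be a finite-length bounded complex of Hilbert spaces of length N. Then the complex admits a joint parametrix, i.e. families of bounded operators P_{l,k}, P_{r,k} : H_{k+1} → H_k (0 ≤ k ≤ N, zero otherwise) such that id_{H_k} − (P_{l,k} ∘ d_k + d_{k-1} ∘ P_{r,k-1}) is compact for every 0 ≤ k ≤ N+1, if and only if it admits a parametrix, i.e. a single family P_k : H_{k+1} → H_k (0 ≤ k ≤ N, zero otherwise) with id_{H_k} − (P_k ∘ d_k + d_{k-1} ∘ P_{k-1}) compact for every 0 ≤ k ≤ N+1. -/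
/-- A finite-length bounded complex of Hilbert spaces `(H k, d k)_{k=0}^N`
(convention: `d k = 0` for `k > N`) admits a joint parametrix if and only if it admits a
parametrix. -/
theorem complex_joint_parametrix_iff_parametrix
    (N : ℕ) (H : ℕ → Type*)
    [∀ k, NormedAddCommGroup (H k)] [∀ k, InnerProductSpace ℂ (H k)] [∀ k, CompleteSpace (H k)]
    (d : ∀ k, H k →L[ℂ] H (k+1))
    (hd0 : ∀ k, N < k → d k = 0)
    (hcomplex : ∀ k, k + 1 ≤ N → ∀ x : H k, d (k+1) (d k x) = 0) :
    (∃ Pl : ∀ k, H (k+1) →L[ℂ] H k, ∃ Pr : ∀ k, H (k+1) →L[ℂ] H k,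
      (∀ k, N < k → Pl k = 0) ∧ (∀ k, N < k → Pr k = 0) ∧
      IsCompactOperator (fun x : H 0 => x - Pl 0 (d 0 x)) ∧
      ∀ j : ℕ, j ≤ N →
        IsCompactOperator (fun x : H (j+1) => x - (Pl (j+1) (d (j+1) x) + d j (Pr j x)))) ↔
    (∃ P : ∀ k, H (k+1) →L[ℂ] H k,
      (∀ k, N < k → P k = 0) ∧
      IsCompactOperator (fun x : H 0 => x - P 0 (d 0 x)) ∧
      ∀ j : ℕ, j ≤ N →
        IsCompactOperator (fun x : H (j+1) => x - (P (j+1) (d (j+1) x) + d j (P j x)))) := by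
  constructor
  · rintro ⟨Pl, Pr, hPl, -, h0, h⟩
    have hl : ∀ k, IsCompactOperator (fun x : H k => d k x - d k (Pl k (d k x))) := by
      intro k
      rcases lt_or_ge N k with hk | hk
      · simpa [hd0 k hk, Pi.zero_def] using
          isCompactOperator_zero (M₁ := H k) (M₂ := H (k + 1))
      · cases k with
        | zero => simpa [Function.comp_def] using h0.clm_comp (d 0)
        | succ j => simpa [Function.comp_def, hcomplex j hk] using
            (h j (by omega)).clm_comp (d (j + 1))
    have hr : ∀ k, IsCompactOperator (fun x : H k => d k x - d k (Pr k (d k x))) := by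
      intro k
      rcases lt_or_ge N k with hk | hk
      · simpa [hd0 k hk, Pi.zero_def] using
          isCompactOperator_zero (M₁ := H k) (M₂ := H (k + 1))
      · have hdd : ∀ x, d (k + 1) (d k x) = 0 := fun x => by
          rcases hk.lt_or_eq with hlt | rfl
          · exact hcomplex k hlt x
          · simp [hd0 (k + 1) (by omega)]
        simpa [Function.comp_def, hdd] using (h k hk).comp_clm (d k)
    refine ⟨fun k => Pl k ∘L d k ∘L Pr k, fun k hk => by simp [hPl k hk], ?_, fun j hj => ?_⟩
    · refine cast (congrArg _ (funext fun x => ?_)) (h0.add ((hr 0).clm_comp (Pl 0)))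
      simp
    · refine cast (congrArg _ (funext fun x => ?_))
        (((h j hj).add ((hr (j + 1)).clm_comp (Pl (j + 1)))).add ((hl j).comp_clm (Pr j)))
      simp only [ContinuousLinearMap.comp_apply, Pi.add_apply, Function.comp_apply, map_sub]
      abel
  · rintro ⟨P, hP, h0, h⟩
    exact ⟨P, P, hP, hP, h0, h⟩
end

section
/- Let (H_k, S_k)_{k=0}^{N} be a finite-length quasicomplex of Hilbert spaces of length N, and let D⁺ : ⊕_k H_{2k} → ⊕_k H_{2k+1} be its even Dirac operator. Then the quasicomplex admits a parametrix if and only if D⁺ is Fredholm, in the sense that there exists a bounded operator Q : ⊕_k H_{2k+1} → ⊕_k H_{2k} such that id − Q ∘ D⁺ and id − D⁺ ∘ Q are compact. -/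
/-- The even Dirac operator `D⁺ : ⊕ₖ H (2k) → ⊕ₖ H (2k+1)` of a finite-length quasicomplex
`(H k, S k)_{k=0}^N` of Hilbert spaces, defined componentwise by
`(D⁺ x) (2k+1) = S (2k) (x (2k)) + (S (2k+1))† (x (2k+2))`.  The direct sums are realized as
`PiLp 2` over `Fin (N+2)`; the components with index `> N+1` are trivial spaces. -/
noncomputable def evenDirac (N : ℕ) (H : ℕ → Type*)
    [∀ k, NormedAddCommGroup (H k)] [∀ k, InnerProductSpace ℂ (H k)] [∀ k, CompleteSpace (H k)]
    (S : ∀ k, H k →L[ℂ] H (k+1)) :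
    PiLp 2 (fun k : Fin (N+2) => H (2*k)) →L[ℂ] PiLp 2 (fun k : Fin (N+2) => H (2*k+1)) :=
  (((PiLp.continuousLinearEquiv 2 ℂ fun k : Fin (N+2) => H (2*k+1)).symm :
      (∀ k : Fin (N+2), H (2*k+1)) →L[ℂ] PiLp 2 fun k : Fin (N+2) => H (2*k+1)).comp
    (ContinuousLinearMap.pi fun k : Fin (N+2) =>
      (S (2*k)).comp (PiLp.proj 2 (fun i : Fin (N+2) => H (2*i)) k) +
        if h : (k : ℕ) + 1 < N + 2 then
          (ContinuousLinearMap.adjoint (S (2*(k:ℕ)+1))).comp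
            (PiLp.proj 2 (fun i : Fin (N+2) => H (2*i)) ⟨(k:ℕ)+1, h⟩)
        else 0))

open ContinuousLinearMap in
/-- Schauder's theorem for operators between Hilbert spaces. -/
theorem IsCompactOperator.hilbert_adjoint {X Y : Type*}
    [NormedAddCommGroup X] [InnerProductSpace ℂ X] [CompleteSpace X]
    [NormedAddCommGroup Y] [InnerProductSpace ℂ Y] [CompleteSpace Y]
    {K : X →L[ℂ] Y} (hK : IsCompactOperator K) : IsCompactOperator (adjoint K) := by
  have hg : IsCompactOperator (K ∘L adjoint K) := hK.comp_clm (adjoint K)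
  refine (isCompactOperator_iff_isCompact_closure_image_closedBall
    (adjoint K : Y →ₗ[ℂ] X) zero_lt_one).2 ?_
  have hTB : TotallyBounded ((K ∘L adjoint K) '' Metric.closedBall 0 1) :=
    ((hg.isCompact_closure_image_closedBall (f := ((K ∘L adjoint K : Y →L[ℂ] Y) : Y →ₗ[ℂ] Y))
      1).totallyBounded).subset subset_closure
  refine TotallyBounded.isCompact_of_isClosed (TotallyBounded.closure ?_) isClosed_closure
  refine Metric.totallyBounded_iff.2 fun ε hε => ?_
  obtain ⟨t, hts, htf, ht⟩ := Set.exists_subset_image_finite_and.1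
    (Metric.finite_approx_of_totallyBounded hTB (ε ^ 2 / 2) (by positivity))
  refine ⟨adjoint K '' t, htf.image _, ?_⟩
  rintro _ ⟨x, hx, rfl⟩
  obtain ⟨_, ⟨y, hy, rfl⟩, hxy⟩ := Set.mem_iUnion₂.1 (ht ⟨x, hx, rfl⟩)
  refine Set.mem_iUnion₂.2 ⟨_, ⟨y, hy, rfl⟩, ?_⟩
  change dist (adjoint K x) (adjoint K y) < ε
  rw [Metric.mem_ball, dist_eq_norm, ← map_sub] at hxy
  rw [dist_eq_norm, ← map_sub]
  have h1 : ‖x - y‖ ≤ 2 := by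
    have hx' := mem_closedBall_zero_iff.1 hx
    have hy' := mem_closedBall_zero_iff.1 (hts hy)
    linarith [norm_sub_le x y]
  have h2 : ‖adjoint K (x - y)‖ ^ 2 ≤ ‖(K ∘L adjoint K) (x - y)‖ * ‖x - y‖ := by
    rw [apply_norm_sq_eq_inner_adjoint_left, adjoint_adjoint]
    exact (RCLike.re_le_norm _).trans (norm_inner_le_norm _ _)
  have h3 : ‖adjoint K (x - y)‖ ^ 2 < ε ^ 2 := by
    nlinarith [norm_nonneg ((K ∘L adjoint K) (x - y))]
  exact lt_of_pow_lt_pow_left₀ 2 hε.le h3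

/-- Equality of bounded operators modulo compact operators. -/
def EqModCompact {X Y : Type*} [NormedAddCommGroup X] [NormedSpace ℂ X]
    [NormedAddCommGroup Y] [NormedSpace ℂ Y] (f g : X →L[ℂ] Y) : Prop :=
  IsCompactOperator (f - g)

namespace EqModCompact

section Normed

variable {X Y Z : Type*} [NormedAddCommGroup X] [NormedSpace ℂ X]
  [NormedAddCommGroup Y] [NormedSpace ℂ Y] [NormedAddCommGroup Z] [NormedSpace ℂ Z]
  {f g h f' g' : X →L[ℂ] Y}

theorem of_eq (h : f = g) : EqModCompact f g := by
  subst h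
  rw [EqModCompact, sub_self]
  exact isCompactOperator_zero

theorem symm (h : EqModCompact f g) : EqModCompact g f := by
  have := h.neg
  rwa [← FunLike.coe_neg, neg_sub] at this

theorem trans (h₁ : EqModCompact f g) (h₂ : EqModCompact g h) : EqModCompact f h := by
  have := h₁.add h₂
  rwa [← FunLike.coe_add, sub_add_sub_cancel] at this

theorem add (h₁ : EqModCompact f g) (h₂ : EqModCompact f' g') :
    EqModCompact (f + f') (g + g') := by
  have := IsCompactOperator.add h₁ h₂
  rwa [← FunLike.coe_add, sub_add_sub_comm] at this

theorem comp_left (k : Y →L[ℂ] Z) (h : EqModCompact f g) : EqModCompact (k ∘L f) (k ∘L g) := by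
  have := h.clm_comp k
  rwa [← ContinuousLinearMap.coe_comp, ContinuousLinearMap.comp_sub] at this

theorem comp_right (h : EqModCompact f g) (k : Z →L[ℂ] X) : EqModCompact (f ∘L k) (g ∘L k) := by
  have := h.comp_clm k
  rwa [← ContinuousLinearMap.coe_comp, ContinuousLinearMap.sub_comp] at this

theorem zero_iff : EqModCompact f 0 ↔ IsCompactOperator f := by
  rw [EqModCompact, sub_zero]

end Normed

end EqModCompact

section HilbertPair

open ContinuousLinearMap EqModCompact

variable {E F : Type*} [NormedAddCommGroup E] [InnerProductSpace ℂ E] [CompleteSpace E]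
  [NormedAddCommGroup F] [InnerProductSpace ℂ F] [CompleteSpace F]

theorem EqModCompact.adjoint {f g : E →L[ℂ] F} (h : EqModCompact f g) :
    EqModCompact (adjoint f) (adjoint g) := by
  have := IsCompactOperator.hilbert_adjoint h
  rwa [map_sub] at this

/-- If the identity factors through `A` and `B†` modulo compact operators, then the Laplacian
`A† A + B B†` is left invertible modulo compact operators. -/
theorem exists_laplacian_leftInverse_modCompact {A q : E →L[ℂ] F} {B p : F →L[ℂ] E}
    (h : EqModCompact (p ∘L A + B ∘L q) (.id ℂ E)) :
    ∃ G : E →L[ℂ] E,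
      EqModCompact (G ∘L (adjoint A ∘L A + B ∘L adjoint B)) (.id ℂ E) := by
  set K : E →L[ℂ] E := .id ℂ E - (p ∘L A + B ∘L q) with hK
  have hKc : EqModCompact K 0 := zero_iff.2 h.symm
  set c : ℝ := 2 * (‖p‖ ^ 2 + ‖q‖ ^ 2) with hc
  set Δ : E →L[ℂ] E := adjoint A ∘L A + B ∘L adjoint B with hΔ
  set M : E →L[ℂ] E := (c : ℂ) • Δ + (2 : ℂ) • K with hM
  have hre (x : E) : RCLike.re (inner ℂ (M x) x) =
      c * (‖A x‖ ^ 2 + ‖adjoint B x‖ ^ 2) + 2 * (‖x‖ ^ 2 -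
        (RCLike.re (inner ℂ (p (A x)) x) + RCLike.re (inner ℂ (q x) (adjoint B x)))) := by
    have hA : inner ℂ (adjoint A (A x)) x = ((‖A x‖ ^ 2 : ℝ) : ℂ) := by
      rw [adjoint_inner_left, inner_self_eq_norm_sq_to_K]; norm_cast
    have hB : inner ℂ (B (adjoint B x)) x = ((‖adjoint B x‖ ^ 2 : ℝ) : ℂ) := by
      rw [← adjoint_inner_right, inner_self_eq_norm_sq_to_K]; norm_cast
    have hx : inner ℂ x x = ((‖x‖ ^ 2 : ℝ) : ℂ) := by
      rw [inner_self_eq_norm_sq_to_K]; norm_cast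
    simp only [hM, hΔ, hK, add_apply, sub_apply, smul_apply, comp_apply, id_apply,
      inner_add_left, inner_sub_left, inner_smul_left, hA, hB, hx, adjoint_inner_right]
    simp [-Complex.ofReal_pow, ← Complex.ofReal_add, ← Complex.ofReal_mul, Complex.mul_re]
  have hMu : IsUnit M := by
    refine isUnit_of_forall_le_norm_inner_map M zero_lt_one fun x => ?_
    refine le_trans ?_ (RCLike.re_le_norm _)
    rw [hre, NNReal.coe_one, mul_one]
    have h1 : RCLike.re (inner ℂ (p (A x)) x) ≤ ‖p‖ * ‖A x‖ * ‖x‖ :=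
      (RCLike.re_le_norm _).trans <| (norm_inner_le_norm _ _).trans <|
        mul_le_mul_of_nonneg_right (p.le_opNorm _) (norm_nonneg _)
    have h2 : RCLike.re (inner ℂ (q x) (adjoint B x)) ≤ ‖q‖ * ‖x‖ * ‖adjoint B x‖ :=
      (RCLike.re_le_norm _).trans <| (norm_inner_le_norm _ _).trans <|
        mul_le_mul_of_nonneg_right (q.le_opNorm _) (norm_nonneg _)
    have h3 := sq_nonneg (2 * (‖p‖ * ‖A x‖) - ‖x‖)
    have h4 := sq_nonneg (2 * (‖q‖ * ‖adjoint B x‖) - ‖x‖)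
    have h5 := sq_nonneg (‖p‖ * ‖adjoint B x‖)
    have h6 := sq_nonneg (‖q‖ * ‖A x‖)
    rw [hc]
    nlinarith
  obtain ⟨G, hG⟩ := hMu.exists_left_inv
  refine ⟨(c : ℂ) • G, ?_⟩
  have key : .id ℂ E - ((c : ℂ) • G) ∘L Δ = G ∘L ((2 : ℂ) • K) := by
    rw [show ContinuousLinearMap.id ℂ E = G ∘L M from hG.symm, hM, comp_add, comp_smul, smul_comp,
      add_sub_cancel_left]
  refine symm (?_ : IsCompactOperator _)
  rw [key]
  exact ((zero_iff.1 hKc).smul (2 : ℂ)).clm_comp G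

variable {A : E →L[ℂ] F} {B : F →L[ℂ] E}

theorem dirac_adjoint_comp_dirac (hBA : EqModCompact (B ∘L A) 0) :
    EqModCompact (adjoint (A + adjoint B) ∘L (A + adjoint B))
      (adjoint A ∘L A + B ∘L adjoint B) := by
  have h₁ : EqModCompact (adjoint A ∘L adjoint B) 0 := by
    simpa [adjoint_comp] using hBA.adjoint
  have h := ((of_eq (rfl : adjoint A ∘L A = _)).add h₁).add
    (hBA.add (of_eq (rfl : B ∘L adjoint B = _)))
  simpa [add_comp, comp_add, add_assoc, add_left_comm, add_comm] using h

theorem dirac_comp_dirac_adjoint (hAB : EqModCompact (A ∘L B) 0) :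
    EqModCompact ((A + adjoint B) ∘L adjoint (A + adjoint B))
      (adjoint B ∘L B + A ∘L adjoint A) := by
  have h := dirac_adjoint_comp_dirac (A := B) (B := A) hAB
  simpa [add_comm] using h

/-- The `ℤ/2`-graded version of the parametrix formula: `G A†` and `G' B†` form a parametrix
whenever `G`, `G'` invert the two Laplacians modulo compact operators. -/
theorem parametrix_of_laplacian_inverse (hBA : EqModCompact (B ∘L A) 0)
    (hAB : EqModCompact (A ∘L B) 0) {G : E →L[ℂ] E} {G' : F →L[ℂ] F}
    (hG : EqModCompact (G ∘L (adjoint A ∘L A + B ∘L adjoint B)) (.id ℂ E))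
    (hG' : EqModCompact ((adjoint B ∘L B + A ∘L adjoint A) ∘L G') (.id ℂ F)) :
    EqModCompact ((G ∘L adjoint A) ∘L A + B ∘L (G' ∘L adjoint B)) (.id ℂ E) := by
  have hBΔ : EqModCompact (B ∘L (adjoint B ∘L B + A ∘L adjoint A))
      ((adjoint A ∘L A + B ∘L adjoint B) ∘L B) := by
    have h₁ := (of_eq (rfl : B ∘L adjoint B ∘L B = _)).add (hBA.comp_right (adjoint A))
    have h₂ := (hAB.comp_left (adjoint A)).add (of_eq (rfl : B ∘L adjoint B ∘L B = _))
    refine trans (g := B ∘L adjoint B ∘L B) ?_ (symm ?_)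
    · simpa [comp_add, comp_assoc] using h₁
    · simpa [add_comp, comp_assoc] using h₂
  have hcomm : EqModCompact (B ∘L G') (G ∘L B) := by
    have h₁ := (hG.comp_right (B ∘L G')).symm
    have h₂ := (hBΔ.symm.comp_right G').comp_left G
    have h₃ := hG'.comp_left (G ∘L B)
    exact h₁.trans (h₂.trans h₃)
  have h := (of_eq (rfl : (G ∘L adjoint A) ∘L A = _)).add (hcomm.comp_right (adjoint B))
  refine h.trans ?_
  simpa [comp_add, comp_assoc] using hG

/-- A `ℤ/2`-graded quasicomplex `A : E → F`, `B : F → E` of Hilbert spaces has a parametrix iff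
its Dirac operator `A + B†` is invertible modulo compact operators. -/
theorem exists_parametrix_iff_dirac_fredholm (hBA : EqModCompact (B ∘L A) 0)
    (hAB : EqModCompact (A ∘L B) 0) :
    (∃ (p : F →L[ℂ] E) (q : E →L[ℂ] F), EqModCompact (p ∘L A + B ∘L q) (.id ℂ E) ∧
      EqModCompact (q ∘L B + A ∘L p) (.id ℂ F)) ↔
    ∃ Q : F →L[ℂ] E, EqModCompact (Q ∘L (A + adjoint B)) (.id ℂ E) ∧
      EqModCompact ((A + adjoint B) ∘L Q) (.id ℂ F) := by
  have hΔ := dirac_adjoint_comp_dirac hBA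
  have hΔ' := dirac_comp_dirac_adjoint hAB
  set D := A + adjoint B with hD
  constructor
  · rintro ⟨p, q, hE, hF⟩
    obtain ⟨G, hG⟩ := exists_laplacian_leftInverse_modCompact hE
    obtain ⟨G', hG'⟩ := exists_laplacian_leftInverse_modCompact hF
    have hL : EqModCompact ((G ∘L adjoint D) ∘L D) (.id ℂ E) := (hΔ.comp_left G).trans hG
    have hR : EqModCompact (D ∘L (adjoint D ∘L adjoint G')) (.id ℂ F) := by
      simpa [adjoint_comp, adjoint_id, comp_assoc] using ((hΔ'.comp_left G').trans hG').adjoint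
    have hLR : EqModCompact (G ∘L adjoint D) (adjoint D ∘L adjoint G') :=
      (hR.comp_left (G ∘L adjoint D)).symm.trans (hL.comp_right (adjoint D ∘L adjoint G'))
    exact ⟨G ∘L adjoint D, hL, (hLR.comp_left D).trans hR⟩
  · rintro ⟨Q, hQD, hDQ⟩
    have hQD' : EqModCompact (adjoint D ∘L adjoint Q) (.id ℂ E) := by
      simpa [adjoint_comp, adjoint_id] using hQD.adjoint
    have hDQ' : EqModCompact (adjoint Q ∘L adjoint D) (.id ℂ F) := by
      simpa [adjoint_comp, adjoint_id] using hDQ.adjoint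
    have hG : EqModCompact ((Q ∘L adjoint Q) ∘L adjoint D ∘L D) (.id ℂ E) :=
      ((hDQ'.comp_right D).comp_left Q).trans hQD
    have hG₂ : EqModCompact ((adjoint D ∘L D) ∘L Q ∘L adjoint Q) (.id ℂ E) :=
      ((hDQ.comp_right (adjoint Q)).comp_left (adjoint D)).trans hQD'
    have hG' : EqModCompact ((adjoint Q ∘L Q) ∘L D ∘L adjoint D) (.id ℂ F) :=
      ((hQD.comp_right (adjoint D)).comp_left (adjoint Q)).trans hDQ'
    have hG'₂ : EqModCompact ((D ∘L adjoint D) ∘L adjoint Q ∘L Q) (.id ℂ F) :=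
      ((hQD'.comp_right Q).comp_left D).trans hDQ
    exact ⟨_, _,
      parametrix_of_laplacian_inverse hBA hAB ((hΔ.symm.comp_left _).trans hG)
        ((hΔ'.symm.comp_right _).trans hG'₂),
      parametrix_of_laplacian_inverse hAB hBA ((hΔ'.symm.comp_left _).trans hG')
        ((hΔ.symm.comp_right _).trans hG₂)⟩

end HilbertPair

section Graded

open ContinuousLinearMap EqModCompact

/-- The operator into an `ℓ²` direct sum with given components. -/
noncomputable def PiLp.ofComponents {ι X : Type*} [Fintype ι] {E : ι → Type*}
    [NormedAddCommGroup X] [NormedSpace ℂ X] [∀ i, NormedAddCommGroup (E i)]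
    [∀ i, NormedSpace ℂ (E i)] (f : ∀ i, X →L[ℂ] E i) : X →L[ℂ] PiLp 2 E :=
  ((PiLp.continuousLinearEquiv 2 ℂ E).symm : (∀ i, E i) →L[ℂ] PiLp 2 E) ∘L .pi f

@[simp]
theorem PiLp.ofComponents_apply {ι X : Type*} [Fintype ι] {E : ι → Type*}
    [NormedAddCommGroup X] [NormedSpace ℂ X] [∀ i, NormedAddCommGroup (E i)]
    [∀ i, NormedSpace ℂ (E i)] (f : ∀ i, X →L[ℂ] E i) (x : X) (i : ι) :
    PiLp.ofComponents f x i = f i x := rfl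

theorem EqModCompact.of_proj {ι X : Type*} [Fintype ι] {E : ι → Type*}
    [NormedAddCommGroup X] [NormedSpace ℂ X] [∀ i, NormedAddCommGroup (E i)]
    [∀ i, NormedSpace ℂ (E i)] {f g : X →L[ℂ] PiLp 2 E}
    (h : ∀ i, EqModCompact (PiLp.proj 2 E i ∘L f) (PiLp.proj 2 E i ∘L g)) :
    EqModCompact f g := by
  choose K hK hKn using h
  refine ⟨_, (isCompact_univ_pi hK).image (PiLp.continuousLinearEquiv 2 ℂ E).symm.continuous, ?_⟩
  filter_upwards [Filter.iInter_mem.2 hKn] with x hx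
  exact ⟨_, fun i _ => Set.mem_iInter.1 hx i, rfl⟩

theorem EqModCompact.congr {X Y : Type*} [NormedAddCommGroup X] [NormedSpace ℂ X]
    [NormedAddCommGroup Y] [NormedSpace ℂ Y] {f g f' g' : X →L[ℂ] Y} (h : EqModCompact f g)
    (hf : ∀ x, f' x = f x) (hg : ∀ x, g' x = g x) : EqModCompact f' g' := by
  rwa [ContinuousLinearMap.ext hf, ContinuousLinearMap.ext hg]

/-- The inclusion of a summand into an `ℓ²` direct sum. -/
noncomputable def PiLp.inclusion {ι : Type*} [Fintype ι] [DecidableEq ι] (E : ι → Type*)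
    [∀ i, NormedAddCommGroup (E i)] [∀ i, NormedSpace ℂ (E i)] (i : ι) : E i →L[ℂ] PiLp 2 E :=
  ((PiLp.continuousLinearEquiv 2 ℂ E).symm : (∀ i, E i) →L[ℂ] PiLp 2 E) ∘L .single ℂ E i

variable {E F : ℕ → Type*} [∀ k, NormedAddCommGroup (E k)] [∀ k, InnerProductSpace ℂ (E k)]
  [∀ k, NormedAddCommGroup (F k)] [∀ k, InnerProductSpace ℂ (F k)]

/-- The diagonal operator between truncated direct sums. -/
noncomputable def diagOp (n : ℕ) (A : ∀ k, E k →L[ℂ] F k) :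
    PiLp 2 (fun k : Fin (n + 1) => E k) →L[ℂ] PiLp 2 (fun k : Fin (n + 1) => F k) :=
  PiLp.ofComponents fun k => A k ∘L PiLp.proj 2 (fun k : Fin (n + 1) => E k) k

/-- The operator between truncated direct sums which raises the index by one. -/
noncomputable def raiseOp (n : ℕ) (B : ∀ k, F k →L[ℂ] E (k + 1)) :
    PiLp 2 (fun k : Fin (n + 1) => F k) →L[ℂ] PiLp 2 (fun k : Fin (n + 1) => E k) :=
  PiLp.ofComponents <| Fin.cases 0
    fun k : Fin n => B k ∘L PiLp.proj 2 (fun k : Fin (n + 1) => F k) k.castSucc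

/-- The operator between truncated direct sums which lowers the index by one. -/
noncomputable def lowerOp (n : ℕ) (B : ∀ k, E (k + 1) →L[ℂ] F k) :
    PiLp 2 (fun k : Fin (n + 1) => E k) →L[ℂ] PiLp 2 (fun k : Fin (n + 1) => F k) :=
  PiLp.ofComponents fun k => if h : (k : ℕ) + 1 < n + 1 then
    B k ∘L PiLp.proj 2 (fun k : Fin (n + 1) => E k) ⟨k + 1, h⟩ else 0

@[simp]
theorem diagOp_apply (n : ℕ) (A : ∀ k, E k →L[ℂ] F k)
    (x : PiLp 2 (fun k : Fin (n + 1) => E k)) (k : Fin (n + 1)) :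
    diagOp n A x k = A k (x k) := rfl

@[simp]
theorem raiseOp_apply_zero (n : ℕ) (B : ∀ k, F k →L[ℂ] E (k + 1))
    (y : PiLp 2 (fun k : Fin (n + 1) => F k)) : raiseOp n B y 0 = 0 := rfl

@[simp]
theorem raiseOp_apply_succ (n : ℕ) (B : ∀ k, F k →L[ℂ] E (k + 1))
    (y : PiLp 2 (fun k : Fin (n + 1) => F k)) (k : Fin n) :
    raiseOp n B y k.succ = B k (y k.castSucc) := rfl

@[simp]
theorem lowerOp_apply_castSucc (n : ℕ) (B : ∀ k, E (k + 1) →L[ℂ] F k)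
    (x : PiLp 2 (fun k : Fin (n + 1) => E k)) (k : Fin n) :
    lowerOp n B x k.castSucc = B k (x k.succ) := by
  have h : (k.castSucc : ℕ) + 1 < n + 1 := by simp
  rw [lowerOp, PiLp.ofComponents_apply, dif_pos h]
  rfl

@[simp]
theorem lowerOp_apply_last (n : ℕ) (B : ∀ k, E (k + 1) →L[ℂ] F k)
    (x : PiLp 2 (fun k : Fin (n + 1) => E k)) : lowerOp n B x (Fin.last n) = 0 := by
  rw [lowerOp, PiLp.ofComponents_apply, dif_neg (by simp)]
  rfl

theorem adjoint_raiseOp [∀ k, CompleteSpace (E k)] [∀ k, CompleteSpace (F k)] (n : ℕ)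
    (B : ∀ k, F k →L[ℂ] E (k + 1)) :
    adjoint (raiseOp n B) = lowerOp n fun k => adjoint (B k) := by
  refine ((eq_adjoint_iff _ _).2 fun x y => ?_).symm
  rw [PiLp.inner_apply, PiLp.inner_apply, Fin.sum_univ_castSucc, Fin.sum_univ_succ]
  simp only [lowerOp_apply_castSucc, lowerOp_apply_last, raiseOp_apply_zero, raiseOp_apply_succ,
    adjoint_inner_left, inner_zero_left, add_zero]
  exact (zero_add _).symm.trans (congrArg (· + _) (inner_zero_right _).symm)

theorem diagOp_single (n : ℕ) (A : ∀ k, E k →L[ℂ] F k) (k : Fin (n + 1)) (x : E k) :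
    diagOp n A (PiLp.single 2 k x) = PiLp.single 2 k (A k x) := by
  ext j
  by_cases h : j = k
  · subst h
    simp
  · simp [h]

theorem raiseOp_single (n : ℕ) (B : ∀ k, F k →L[ℂ] E (k + 1)) (k : Fin n) (y : F k) :
    raiseOp n B (PiLp.single 2 k.castSucc y) =
      PiLp.single (β := fun k : Fin (n + 1) => E k) 2 k.succ (B k y) := by
  ext j
  refine Fin.cases ?_ (fun j => ?_) j
  · rw [PiLp.single_eq_of_ne 2 (Fin.succ_ne_zero k).symm, raiseOp_apply_zero]
  · rw [raiseOp_apply_succ]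
    by_cases h : j = k
    · subst h
      simp
    · rw [PiLp.single_eq_of_ne 2 (by simpa using h), PiLp.single_eq_of_ne 2 (by simpa using h),
        map_zero]

theorem exists_graded_parametrix_iff [∀ k, CompleteSpace (E k)] [∀ k, CompleteSpace (F k)] (n : ℕ)
    [Subsingleton (F n)] (A : ∀ k, E k →L[ℂ] F k) (B : ∀ k, F k →L[ℂ] E (k + 1))
    (hBA : ∀ k, EqModCompact (B k ∘L A k) 0)
    (hAB : ∀ k, EqModCompact (A (k + 1) ∘L B k) 0) :
    (∃ (p : ∀ k, F k →L[ℂ] E k) (q : ∀ k, E (k + 1) →L[ℂ] F k),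
      EqModCompact (p 0 ∘L A 0) (.id ℂ (E 0)) ∧
      (∀ k < n, EqModCompact (p (k + 1) ∘L A (k + 1) + B k ∘L q k) (.id ℂ (E (k + 1)))) ∧
      ∀ k < n, EqModCompact (q k ∘L B k + A k ∘L p k) (.id ℂ (F k))) ↔
    ∃ Q : PiLp 2 (fun k : Fin (n + 1) => F k) →L[ℂ] PiLp 2 (fun k : Fin (n + 1) => E k),
      EqModCompact (Q ∘L (diagOp n A + lowerOp n fun k => adjoint (B k))) (.id ℂ _) ∧
      EqModCompact ((diagOp n A + lowerOp n fun k => adjoint (B k)) ∘L Q) (.id ℂ _) := by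
  rw [← adjoint_raiseOp, ← exists_parametrix_iff_dirac_fredholm]
  · constructor
    · rintro ⟨p, q, h0, hE, hF⟩
      refine ⟨diagOp n p, lowerOp n q, of_proj (Fin.cases ?_ fun k => ?_),
        of_proj (Fin.lastCases ?_ fun k => ?_)⟩
      · refine (h0.comp_right (PiLp.proj 2 (fun k : Fin (n + 1) => E k) 0)).congr (fun x => ?_)
          fun x => rfl
        exact add_zero _
      · refine ((hE k k.2).comp_right (PiLp.proj 2 (fun k : Fin (n + 1) => E k) k.succ)).congr
          (fun x => ?_) fun x => rfl
        exact congrArg (p (k + 1) (A (k + 1) (x k.succ)) + B k ·) (lowerOp_apply_castSucc n q x k)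
      · exact of_eq (ContinuousLinearMap.ext fun x => Subsingleton.elim (α := F n) _ _)
      · refine ((hF k k.2).comp_right (PiLp.proj 2 (fun k : Fin (n + 1) => F k) k.castSucc)).congr
          (fun x => ?_) fun x => rfl
        exact congrArg (· + A k (p k (x k.castSucc)))
          (lowerOp_apply_castSucc n q (raiseOp n B x) k)
    · rintro ⟨P, R, hE, hF⟩
      let p (k : ℕ) : F k →L[ℂ] E k := if h : k < n + 1 then
        PiLp.proj 2 (fun k : Fin (n + 1) => E k) ⟨k, h⟩ ∘L P ∘L
          PiLp.inclusion (fun k : Fin (n + 1) => F k) ⟨k, h⟩ else 0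
      let q (k : ℕ) : E (k + 1) →L[ℂ] F k := if h : k + 1 < n + 1 then
        PiLp.proj 2 (fun k : Fin (n + 1) => F k) ⟨k, k.lt_succ_self.trans h⟩ ∘L R ∘L
          PiLp.inclusion (fun k : Fin (n + 1) => E k) ⟨k + 1, h⟩ else 0
      have hp (k : Fin (n + 1)) (y : F k) : p k y = P (PiLp.single 2 k y) k := by
        simp only [p, dif_pos k.2]
        rfl
      have hq (k : Fin n) (x : E (k + 1)) : q k x =
          R (PiLp.single (β := fun k : Fin (n + 1) => E k) 2 k.succ x) k.castSucc := by
        simp only [q, dif_pos (Nat.succ_lt_succ k.2)]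
        rfl
      refine ⟨p, q, ?_, fun k hk => ?_, fun k hk => ?_⟩
      · refine ((hE.comp_left (PiLp.proj 2 (fun k : Fin (n + 1) => E k) 0)).comp_right
          (PiLp.inclusion (fun k : Fin (n + 1) => E k) 0)).congr (fun x => ?_) fun x => ?_
        · refine (hp 0 (A 0 x)).trans ?_
          exact (congrArg (P · 0) (diagOp_single n A 0 x).symm).trans (add_zero _).symm
        · exact (PiLp.single_eq_same 2 (β := fun k : Fin (n + 1) => E k) 0 x).symm
      · lift k to Fin n using hk
        refine ((hE.comp_left (PiLp.proj 2 (fun k : Fin (n + 1) => E k) k.succ)).comp_right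
          (PiLp.inclusion (fun k : Fin (n + 1) => E k) k.succ)).congr (fun x => ?_) fun x => ?_
        · exact congrArg₂ (fun a b : E (k + 1) => a + b) ((hp k.succ (A (k + 1) x)).trans
            (congrArg (P · k.succ) (diagOp_single n A k.succ x).symm)) (congrArg (B k) (hq k x))
        · exact (PiLp.single_eq_same 2 (β := fun k : Fin (n + 1) => E k) k.succ x).symm
      · lift k to Fin n using hk
        refine ((hF.comp_left (PiLp.proj 2 (fun k : Fin (n + 1) => F k) k.castSucc)).comp_right
          (PiLp.inclusion (fun k : Fin (n + 1) => F k) k.castSucc)).congr (fun x => ?_)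
          fun x => ?_
        · exact congrArg₂ (· + ·) ((hq k (B k x)).trans
            (congrArg (R · k.castSucc) (raiseOp_single n B k x).symm))
            (congrArg (A k) (hp k.castSucc x))
        · exact (PiLp.single_eq_same 2 (β := fun k : Fin (n + 1) => F k) k.castSucc x).symm
  · refine of_proj (Fin.cases ?_ fun k => ?_)
    · exact of_eq rfl
    · exact (hBA k).comp_right (PiLp.proj 2 (fun k : Fin (n + 1) => E k) k.castSucc)
  · refine of_proj (Fin.cases ?_ fun k => ?_)
    · exact of_eq (ContinuousLinearMap.ext fun x => map_zero (A 0))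
    · exact (hAB k).comp_right (PiLp.proj 2 (fun k : Fin (n + 1) => F k) k.castSucc)

end Graded

theorem exists_of_even_odd {C : ℕ → Type*} (f : ∀ m, C (2 * m)) (g : ∀ m, C (2 * m + 1)) :
    ∃ P : ∀ k, C k, (∀ m, P (2 * m) = f m) ∧ ∀ m, P (2 * m + 1) = g m := by
  have h (k : ℕ) : ∃ c : C k, (∀ m, k = 2 * m → c ≍ f m) ∧ ∀ m, k = 2 * m + 1 → c ≍ g m := by
    obtain ⟨m, rfl | rfl⟩ := Nat.even_or_odd' k
    · refine ⟨f m, fun m' hm => ?_, fun m' hm => by omega⟩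
      obtain rfl : m = m' := by omega
      rfl
    · refine ⟨g m, fun m' hm => by omega, fun m' hm => ?_⟩
      obtain rfl : m = m' := by omega
      rfl
  choose P hf hg using h
  exact ⟨P, fun m => eq_of_heq (hf _ m rfl), fun m => eq_of_heq (hg _ m rfl)⟩

theorem evenDirac_eq_diagOp_add_lowerOp (N : ℕ) (H : ℕ → Type*)
    [∀ k, NormedAddCommGroup (H k)] [∀ k, InnerProductSpace ℂ (H k)] [∀ k, CompleteSpace (H k)]
    (S : ∀ k, H k →L[ℂ] H (k + 1)) :
    evenDirac N H S = diagOp (E := fun k => H (2 * k)) (F := fun k => H (2 * k + 1)) (N + 1)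
        (fun k => S (2 * k)) +
      lowerOp (E := fun k => H (2 * k)) (F := fun k => H (2 * k + 1)) (N + 1)
        fun k => ContinuousLinearMap.adjoint (S (2 * k + 1)) := rfl

/-- A finite-length quasicomplex of Hilbert spaces `(H k, S k)_{k=0}^N`
(convention: `S k = 0` for `k > N`, and the spaces `H k` for `k > N+1` are trivial) admits a
parametrix if and only if its even Dirac operator `D⁺` is Fredholm. -/
theorem quasicomplex_parametrix_iff_evenDirac_fredholm
    (N : ℕ) (H : ℕ → Type*)
    [∀ k, NormedAddCommGroup (H k)] [∀ k, InnerProductSpace ℂ (H k)] [∀ k, CompleteSpace (H k)]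
    (htriv : ∀ k, N + 1 < k → Subsingleton (H k))
    (S : ∀ k, H k →L[ℂ] H (k+1))
    (hS0 : ∀ k, N < k → S k = 0)
    (hquasi : ∀ k, k + 1 ≤ N → IsCompactOperator (fun x : H k => S (k+1) (S k x))) :
    (∃ P : ∀ k, H (k+1) →L[ℂ] H k,
      (∀ k, N < k → P k = 0) ∧
      IsCompactOperator (fun x : H 0 => x - P 0 (S 0 x)) ∧
      ∀ j : ℕ, j ≤ N →
        IsCompactOperator (fun x : H (j+1) => x - (P (j+1) (S (j+1) x) + S j (P j x)))) ↔
    (∃ Q : PiLp 2 (fun k : Fin (N+2) => H (2*k+1)) →L[ℂ] PiLp 2 (fun k : Fin (N+2) => H (2*k)),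
      IsCompactOperator
        (fun x : PiLp 2 (fun k : Fin (N+2) => H (2*k)) => x - Q (evenDirac N H S x)) ∧
      IsCompactOperator
        (fun y : PiLp 2 (fun k : Fin (N+2) => H (2*k+1)) => y - evenDirac N H S (Q y))) := by
  have hSS (k : ℕ) : EqModCompact (S (k + 1) ∘L S k) 0 := by
    rw [EqModCompact.zero_iff]
    by_cases hk : k + 1 ≤ N
    · exact hquasi k hk
    · rw [hS0 (k + 1) (by omega), ContinuousLinearMap.zero_comp]
      exact isCompactOperator_zero
  have : Subsingleton (H (2 * (N + 1) + 1)) := htriv _ (by omega)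
  have key := exists_graded_parametrix_iff (E := fun k => H (2 * k)) (F := fun k => H (2 * k + 1))
    (N + 1) (fun k => S (2 * k)) (fun k => S (2 * k + 1)) (fun k => hSS (2 * k))
    (fun k => hSS (2 * k + 1))
  rw [← evenDirac_eq_diagOp_add_lowerOp] at key
  refine Iff.trans ?_ (key.trans ?_)
  · constructor
    · rintro ⟨P, -, h0, hP⟩
      have hP' (j : ℕ) :
          EqModCompact (P (j + 1) ∘L S (j + 1) + S j ∘L P j) (.id ℂ (H (j + 1))) := by
        by_cases hj : j ≤ N
        · exact EqModCompact.symm (hP j hj)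
        · have : Subsingleton (H (j + 1)) := htriv _ (by omega)
          exact EqModCompact.of_eq (ContinuousLinearMap.ext fun x => Subsingleton.elim _ _)
      exact ⟨fun k => P (2 * k), fun k => P (2 * k + 1), EqModCompact.symm h0,
        fun k _ => hP' (2 * k + 1), fun k _ => hP' (2 * k)⟩
    · rintro ⟨p, q, h0, hE, hF⟩
      obtain ⟨P, hp, hq⟩ := exists_of_even_odd (C := fun k => H (k + 1) →L[ℂ] H k) p q
      refine ⟨P, fun k hk => ?_, ?_, fun j hj => ?_⟩
      · have : Subsingleton (H (k + 1)) := htriv _ (by omega)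
        exact ContinuousLinearMap.ext fun x => by rw [Subsingleton.elim x 0, map_zero, map_zero]
      · rw [show P 0 = p 0 from hp 0]
        exact h0.symm
      · obtain ⟨m, rfl | rfl⟩ := Nat.even_or_odd' j
        · rw [hp, hq]
          exact (hF m (by omega)).symm
        · rw [show P (2 * m + 1 + 1) = p (m + 1) from hp (m + 1), hq]
          exact (hE m (by omega)).symm
  · exact exists_congr fun Q => and_congr
      ⟨EqModCompact.symm, fun h => EqModCompact.symm (f := .id ℂ _) h⟩
      ⟨EqModCompact.symm, fun h => EqModCompact.symm (f := .id ℂ _) h⟩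
end
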